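/- Let n ≥ 3 be an integer, m = (n−2)/(n+2), β > 0, and γ = (2β−1)/(1−m) (expander case ρ = −1). Then for every λ > 0 there exists a positive smooth radially symmetric function u on ℝⁿ with u(0) = λ solving ((n−1)/m)·Δ(u^m) + β·(x·∇u) + γ·u = 0 on all of ℝⁿ. -/

import Mathlib

open Real MeasureTheory Metric
open scoped Topology RealInnerProductSpace

noncomputable section

/-- Euclidean space ℝⁿ. -/
abbrev Euc (n : ℕ) := EuclideanSpace ℝ (Fin n)

/-- Euclidean Laplacian: sum of pure second derivatives in the coordinate directions. -/
def lap {n : ℕ} (f : Euc n → ℝ) (x : Euc n) : ℝ :=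
  ∑ i : Fin n, fderiv ℝ (fun y => fderiv ℝ f y (EuclideanSpace.single i 1)) x
    (EuclideanSpace.single i 1)

/-- The conformally flat Yamabe soliton equation
`((n-1)/m)·Δ(u^m) + β·(x·∇u) + γ·u = 0` on ℝⁿ. -/
def YamabePDE {n : ℕ} (m β γ : ℝ) (u : Euc n → ℝ) : Prop :=
  ∀ x : Euc n, ((n : ℝ) - 1) / m * lap (fun y => u y ^ m) x
      + β * ⟪x, gradient u x⟫ + γ * u x = 0

/-- A function on ℝⁿ is radially symmetric if it depends only on the norm. -/
def IsRadial {n : ℕ} (u : Euc n → ℝ) : Prop :=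
  ∀ x y : Euc n, ‖x‖ = ‖y‖ → u x = u y

/-- Scalar curvature of the conformally flat metric g = u^{4/(n+2)}·dx²:
`R = -(4(n-1)/(n-2))·u⁻¹·Δ(u^m)`. -/
def scalarCurv {n : ℕ} (m : ℝ) (u : Euc n → ℝ) (x : Euc n) : ℝ :=
  -(4 * ((n : ℝ) - 1) / ((n : ℝ) - 2)) * lap (fun y => u y ^ m) x / u x

/-- Global solvability of `g' = N g`, `g 0 = a` on `[0, ∞)` for a causal operator `N` which is
Lipschitz on bounded time intervals. -/
theorem exists_hasDerivAt_of_causal_lipschitz (N : (ℝ → ℝ) → ℝ → ℝ) (L ω : ℝ → ℝ) (a : ℝ)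
    (hN : ∀ f, Continuous f → Continuous (N f)) (hN0 : N (fun _ => 0) = fun _ => 0)
    (hL : Continuous L) (hL0 : ∀ t, 0 ≤ L t) (hω : ∀ t, HasDerivAt ω (2 * L t) t)
    (hlip : ∀ f g, Continuous f → Continuous g → ∀ t, 0 ≤ t → ∀ D : ℝ,
      (∀ s, 0 ≤ s → s ≤ t → |f s - g s| ≤ D) → |N f t - N g t| ≤ L t * D) :
    ∃ g : ℝ → ℝ, g 0 = a ∧ ∀ t, 0 ≤ t → HasDerivAt g (N g t) t := by
  have hωc : Continuous ω := continuous_iff_continuousAt.2 fun t => (hω t).continuousAt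
  have hωm : Monotone ω := monotone_of_deriv_nonneg (fun t => (hω t).differentiableAt)
    fun t => by rw [(hω t).deriv]; have := hL0 t; positivity
  set E : ℝ → ℝ := fun s => exp (ω s) with hE
  have hEc : Continuous E := by fun_prop
  have hEpos : ∀ s, 0 < E s := fun s => exp_pos _
  have hEm : Monotone E := fun s t h => exp_le_exp.2 (hωm h)
  have hEint : ∀ s, ∫ t in (0 : ℝ)..s, L t * E t = (E s - E 0) / 2 := by
    intro s
    have hd : ∀ t ∈ Set.uIcc 0 s, HasDerivAt (fun t => E t / 2) (L t * E t) t := by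
      intro t _
      refine ((hω t).exp.div_const 2).congr_deriv ?_
      simp only [hE]; ring
    rw [intervalIntegral.integral_eq_sub_of_hasDerivAt hd
      ((hL.mul hEc).intervalIntegrable _ _)]
    ring
  have key : ∀ f g, Continuous f → Continuous g → ∀ D : ℝ, 0 ≤ D →
      (∀ s, |f s - g s| ≤ E s * D) → ∀ s, 0 ≤ s →
      |(∫ t in (0 : ℝ)..s, N f t) - ∫ t in (0 : ℝ)..s, N g t| ≤ E s * (D / 2) := by
    intro f g hf hg D hD hfg s hs
    rw [← intervalIntegral.integral_sub ((hN f hf).intervalIntegrable _ _)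
      ((hN g hg).intervalIntegrable _ _)]
    have h1 : ‖∫ t in (0 : ℝ)..s, (N f t - N g t)‖ ≤ ∫ t in (0 : ℝ)..s, L t * E t * D := by
      refine intervalIntegral.norm_integral_le_of_norm_le hs ?_
        (((hL.mul hEc).mul continuous_const).intervalIntegrable _ _)
      refine Filter.Eventually.of_forall fun t ht => ?_
      rw [mul_assoc]
      refine hlip f g hf hg t ht.1.le _ fun r _ hr => (hfg r).trans ?_
      exact mul_le_mul_of_nonneg_right (hEm hr) hD
    rw [intervalIntegral.integral_mul_const, hEint, Real.norm_eq_abs] at h1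
    refine h1.trans ?_
    have := mul_nonneg (hEpos 0).le hD
    nlinarith
  have hcont : ∀ f, Continuous f → Continuous fun s => ∫ t in (0 : ℝ)..s, N f t := fun f hf =>
    intervalIntegral.continuous_primitive (fun x y => (hN f hf).intervalIntegrable x y) 0
  let lift : BoundedContinuousFunction ℝ ℝ → ℝ → ℝ := fun w s => E s * w s
  have hlift : ∀ w, Continuous (lift w) := fun w => hEc.mul w.continuous
  let T0 : BoundedContinuousFunction ℝ ℝ → ℝ → ℝ := fun w s =>
    (E (max s 0))⁻¹ * (a + ∫ t in (0 : ℝ)..(max s 0), N (lift w) t)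
  have hT0c : ∀ w, Continuous (T0 w) := by
    intro w
    have hm : Continuous fun s : ℝ => max s 0 := by fun_prop
    exact ((hEc.comp hm).inv₀ fun s => (hEpos _).ne').mul
      (continuous_const.add ((hcont _ (hlift w)).comp hm))
  have hT0d : ∀ w w' s, |T0 w s - T0 w' s| ≤ dist w w' / 2 := by
    intro w w' s
    have h := key (lift w) (lift w') (hlift w) (hlift w') (dist w w') dist_nonneg
      (fun r => by
        change |E r * w r - E r * w' r| ≤ _
        rw [← mul_sub, abs_mul, abs_of_pos (hEpos r)]
        exact mul_le_mul_of_nonneg_left (w.dist_coe_le_dist r) (hEpos r).le)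
      (max s 0) (le_max_right _ _)
    simp only [T0]
    rw [← mul_sub, add_sub_add_left_eq_sub, abs_mul, abs_of_pos (inv_pos.2 (hEpos _)),
      inv_mul_le_iff₀ (hEpos _)]
    exact h
  have hT0z : ∀ s, |T0 0 s| ≤ (E 0)⁻¹ * |a| := by
    intro s
    have : lift 0 = fun _ => 0 := by funext s; simp [lift]
    simp only [T0, this, hN0, intervalIntegral.integral_zero, add_zero]
    rw [abs_mul, abs_of_pos (inv_pos.2 (hEpos _))]
    exact mul_le_mul_of_nonneg_right
      (inv_anti₀ (hEpos 0) (hEm (le_max_right _ _))) (abs_nonneg _)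
  let T : BoundedContinuousFunction ℝ ℝ → BoundedContinuousFunction ℝ ℝ := fun w =>
    BoundedContinuousFunction.ofNormedAddCommGroup (T0 w) (hT0c w)
      ((E 0)⁻¹ * |a| + dist w 0 / 2) (fun s => by
        have h1 := hT0d w 0 s
        have h2 := hT0z s
        rw [Real.norm_eq_abs]
        have h3 := abs_add_le (T0 w s - T0 0 s) (T0 0 s)
        rw [sub_add_cancel] at h3
        linarith)
  have hT : ContractingWith (1 / 2) T := by
    refine ⟨by rw [← NNReal.coe_lt_coe]; norm_num, LipschitzWith.of_dist_le_mul fun w w' => ?_⟩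
    rw [BoundedContinuousFunction.dist_le (by positivity)]
    intro s
    refine (hT0d w w' s).trans (le_of_eq ?_)
    push_cast; ring
  set w := hT.fixedPoint T with hw
  have hfix : ∀ s, T0 w s = w s := fun s =>
    congrArg (fun v : BoundedContinuousFunction ℝ ℝ => v s) hT.fixedPoint_isFixedPt
  have heq : ∀ s, 0 ≤ s → lift w s = a + ∫ t in (0 : ℝ)..s, N (lift w) t := by
    intro s hs
    simp only [lift]
    rw [← hfix s]
    simp only [T0, max_eq_left hs]
    rw [mul_inv_cancel_left₀ (hEpos s).ne']
  have hd : ∀ t, HasDerivAt (fun s => a + ∫ r in (0 : ℝ)..s, N (lift w) r) (N (lift w) t) t :=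
    fun t => ((hN _ (hlift w)).integral_hasStrictDerivAt 0 t).hasDerivAt.const_add a
  refine ⟨fun s => a + ∫ t in (0 : ℝ)..s, N (lift w) t, by simp, fun t ht => ?_⟩
  have h := hlip (lift w) (fun s => a + ∫ t in (0 : ℝ)..s, N (lift w) t) (hlift w)
    (continuous_const.add (hcont _ (hlift w))) t ht 0 fun s hs _ => by
      rw [heq s hs, sub_self, abs_zero]
  rw [mul_zero] at h
  have h' := sub_eq_zero.1 (abs_eq_zero.1 (le_antisymm h (abs_nonneg _)))
  rw [← h']
  exact hd t

/-- The weighted average `s ↦ ∫₀¹ τ ^ α h(s τ) dτ` of `h` over the segment from `0` to `s`. -/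
def segmentAvg (α : ℝ) (h : ℝ → ℝ) (s : ℝ) : ℝ := ∫ τ in (0 : ℝ)..1, τ ^ α * h (s * τ)

theorem segmentAvg_congr {α : ℝ} {h k : ℝ → ℝ} (hk : Set.EqOn h k (Set.Ici 0)) :
    Set.EqOn (segmentAvg α h) (segmentAvg α k) (Set.Ici 0) := by
  intro s hs
  refine intervalIntegral.integral_congr fun τ hτ => ?_
  rw [Set.uIcc_of_le zero_le_one] at hτ
  rw [hk (mul_nonneg hs hτ.1 : (0 : ℝ) ≤ s * τ)]

theorem continuous_segmentAvg {α : ℝ} (hα : 0 ≤ α) {h : ℝ → ℝ} (hh : Continuous h) :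
    Continuous (segmentAvg α h) := by
  refine intervalIntegral.continuous_parametric_intervalIntegral_of_continuous' ?_ 0 1
  have : Continuous fun τ : ℝ => τ ^ α := Real.continuous_rpow_const hα
  exact (this.comp continuous_snd).mul (hh.comp (continuous_fst.mul continuous_snd))

theorem segmentAvg_nonneg {α : ℝ} {h : ℝ → ℝ} {s : ℝ} (hs : 0 ≤ s)
    (hh : ∀ t, 0 ≤ t → 0 ≤ h t) : 0 ≤ segmentAvg α h s :=
  intervalIntegral.integral_nonneg zero_le_one fun _ hτ =>
    mul_nonneg (rpow_nonneg hτ.1 _) (hh _ (mul_nonneg hs hτ.1))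

theorem abs_segmentAvg_sub_le {α : ℝ} (hα : 0 ≤ α) {h k : ℝ → ℝ} (hh : Continuous h)
    (hk : Continuous k) {s D : ℝ} (hs : 0 ≤ s) (hD : ∀ t, 0 ≤ t → t ≤ s → |h t - k t| ≤ D) :
    |segmentAvg α h s - segmentAvg α k s| ≤ D := by
  have hτc : Continuous fun τ : ℝ => τ ^ α := Real.continuous_rpow_const hα
  unfold segmentAvg
  rw [← intervalIntegral.integral_sub
    (Continuous.intervalIntegrable (by fun_prop) _ _)
    (Continuous.intervalIntegrable (by fun_prop) _ _)]
  have := intervalIntegral.norm_integral_le_of_norm_le_const (a := 0) (b := 1) (C := D)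
    (f := fun τ : ℝ => τ ^ α * h (s * τ) - τ ^ α * k (s * τ)) fun τ hτ => by
      rw [Set.uIoc_of_le zero_le_one] at hτ
      rw [← mul_sub, norm_mul, Real.norm_eq_abs, Real.norm_eq_abs,
        abs_of_nonneg (rpow_nonneg hτ.1.le _)]
      have h1 := hD (s * τ) (mul_nonneg hs hτ.1.le) (mul_le_of_le_one_right hs hτ.2)
      have h2 : τ ^ α ≤ 1 := rpow_le_one hτ.1.le hτ.2 hα
      calc _ ≤ 1 * |h (s * τ) - k (s * τ)| := mul_le_mul_of_nonneg_right h2 (abs_nonneg _)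
        _ ≤ D := by rw [one_mul]; exact h1
  simpa using this

/-- Differentiation of `segmentAvg` under the integral sign, for a globally `C¹` function. -/
theorem hasDerivAt_segmentAvg {α : ℝ} (hα : 0 ≤ α) {h h' : ℝ → ℝ} (hh' : Continuous h')
    (hd : ∀ s, HasDerivAt h (h' s) s) (s : ℝ) :
    HasDerivAt (segmentAvg α h) (segmentAvg (α + 1) h' s) s := by
  have hτc : Continuous fun τ : ℝ => τ ^ α := Real.continuous_rpow_const hα
  have hτc' : Continuous fun τ : ℝ => τ ^ (α + 1) := Real.continuous_rpow_const (by linarith)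
  have hh : Continuous h := continuous_iff_continuousAt.2 fun t => (hd t).continuousAt
  obtain ⟨C, hC⟩ := (isCompact_Icc (a := -(|s| + 1)) (b := |s| + 1)).exists_bound_of_continuousOn
    hh'.continuousOn
  refine (intervalIntegral.hasDerivAt_integral_of_dominated_loc_of_deriv_le
    (F := fun s τ => τ ^ α * h (s * τ)) (F' := fun s τ => τ ^ (α + 1) * h' (s * τ))
    (bound := fun _ => C) (Metric.ball_mem_nhds s one_pos) ?_ ?_ ?_ ?_ ?_ ?_).2
  · exact Filter.Eventually.of_forall fun x =>
      Continuous.aestronglyMeasurable (by fun_prop)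
  · exact Continuous.intervalIntegrable (by fun_prop) _ _
  · exact Continuous.aestronglyMeasurable (by fun_prop)
  · refine Filter.Eventually.of_forall fun τ hτ x hx => ?_
    rw [Set.uIoc_of_le zero_le_one] at hτ
    rw [norm_mul, Real.norm_eq_abs, abs_of_nonneg (rpow_nonneg hτ.1.le _)]
    have hx1 : |x| ≤ |s| + 1 := by
      rw [Metric.mem_ball, Real.dist_eq] at hx
      have := abs_add_le (x - s) s
      rw [sub_add_cancel] at this
      linarith
    have hx2 : |x * τ| ≤ |s| + 1 := by
      rw [abs_mul, abs_of_pos hτ.1]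
      exact (mul_le_of_le_one_right (abs_nonneg _) hτ.2).trans hx1
    have h1 := hC (x * τ) (abs_le.1 hx2)
    have h2 : τ ^ (α + 1) ≤ 1 := rpow_le_one hτ.1.le hτ.2 (by linarith)
    calc _ ≤ 1 * ‖h' (x * τ)‖ := mul_le_mul_of_nonneg_right h2 (norm_nonneg _)
      _ ≤ C := by rw [one_mul]; exact h1
  · exact intervalIntegrable_const
  · refine Filter.Eventually.of_forall fun τ hτ x _ => ?_
    rw [Set.uIoc_of_le zero_le_one] at hτ
    have h1 : HasDerivAt (fun y : ℝ => y * τ) τ x := by simpa using (hasDerivAt_id x).mul_const τ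
    have h2 := ((hd (x * τ)).comp x h1).const_mul (τ ^ α)
    refine h2.congr_deriv ?_
    rw [rpow_add hτ.1, rpow_one]; ring

/-- A function that is `C¹` on `[0, ∞)` extends to a `C¹` function on the line. -/
theorem exists_extension_of_hasDerivWithinAt {h h' : ℝ → ℝ} (hh' : ContinuousOn h' (Set.Ici 0))
    (hd : ∀ s ∈ Set.Ici (0 : ℝ), HasDerivWithinAt h (h' s) (Set.Ici 0) s) :
    ∃ k k' : ℝ → ℝ, Continuous k' ∧ (∀ s, HasDerivAt k (k' s) s) ∧
      Set.EqOn h k (Set.Ici 0) ∧ Set.EqOn h' k' (Set.Ici 0) := by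
  set k' : ℝ → ℝ := fun s => h' (max s 0) with hk'
  have hc : Continuous k' := by
    refine hh'.comp_continuous (by fun_prop) fun s => Set.mem_Ici.2 (le_max_right _ _)
  have heq : Set.EqOn h' k' (Set.Ici 0) := fun s hs => by
    simp only [hk', max_eq_left (Set.mem_Ici.1 hs)]
  refine ⟨fun s => h 0 + ∫ t in (0 : ℝ)..s, k' t, k', hc,
    fun s => (hc.integral_hasStrictDerivAt 0 s).hasDerivAt.const_add _, fun s hs => ?_, heq⟩
  have hcont : ContinuousOn h (Set.Ici 0) := fun t ht => (hd t ht).continuousWithinAt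
  have hs' : (0 : ℝ) ≤ s := hs
  have := intervalIntegral.integral_eq_sub_of_hasDeriv_right_of_le (f := h) (f' := k') hs'
    (hcont.mono Set.Icc_subset_Ici_self)
    (fun t ht => by
      rw [← heq (Set.mem_Ici.2 ht.1.le)]
      exact (hd t ht.1.le).mono fun r hr => (ht.1.trans hr).le)
    (hc.intervalIntegrable _ _)
  simp only
  rw [this]; ring

theorem hasDerivWithinAt_segmentAvg {α : ℝ} (hα : 0 ≤ α) {h h' : ℝ → ℝ}
    (hh' : ContinuousOn h' (Set.Ici 0))
    (hd : ∀ s ∈ Set.Ici (0 : ℝ), HasDerivWithinAt h (h' s) (Set.Ici 0) s) {s : ℝ}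
    (hs : s ∈ Set.Ici (0 : ℝ)) :
    HasDerivWithinAt (segmentAvg α h) (segmentAvg (α + 1) h' s) (Set.Ici 0) s := by
  obtain ⟨k, k', hk', hkd, hk, hkk'⟩ := exists_extension_of_hasDerivWithinAt hh' hd
  rw [segmentAvg_congr hkk' hs]
  exact (hasDerivAt_segmentAvg hα hk' hkd s).hasDerivWithinAt.congr
    (segmentAvg_congr hk) (segmentAvg_congr hk hs)

/-- Integration by parts along the segment from `0` to `s`. -/
theorem mul_segmentAvg_deriv {α : ℝ} (hα : 0 ≤ α) {h h' : ℝ → ℝ}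
    (hh' : ContinuousOn h' (Set.Ici 0))
    (hd : ∀ s ∈ Set.Ici (0 : ℝ), HasDerivWithinAt h (h' s) (Set.Ici 0) s) {s : ℝ}
    (hs : s ∈ Set.Ici (0 : ℝ)) :
    s * segmentAvg (α + 1) h' s = h s - (α + 1) * segmentAvg α h s := by
  obtain ⟨k, k', hk', hkd, hk, hkk'⟩ := exists_extension_of_hasDerivWithinAt hh' hd
  rw [segmentAvg_congr hkk' hs, segmentAvg_congr hk hs, hk hs]
  have hτc : Continuous fun τ : ℝ => τ ^ α := Real.continuous_rpow_const hα
  have hkc : Continuous k := continuous_iff_continuousAt.2 fun t => (hkd t).continuousAt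
  have hpow : ∀ τ : ℝ, HasDerivAt (fun τ : ℝ => τ ^ (α + 1)) ((α + 1) * τ ^ α) τ := fun τ => by
    simpa using Real.hasDerivAt_rpow_const (x := τ) (p := α + 1) (Or.inr (by linarith))
  have hcomp : ∀ τ : ℝ, HasDerivAt (fun τ : ℝ => k (s * τ)) (s * k' (s * τ)) τ := fun τ => by
    have h1 : HasDerivAt (fun y : ℝ => s * y) s τ := by
      simpa using (hasDerivAt_id τ).const_mul s
    have := (hkd (s * τ)).comp τ h1
    rwa [mul_comm] at this
  have H := intervalIntegral.integral_mul_deriv_eq_deriv_mul (a := 0) (b := 1)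
    (fun τ _ => hpow τ) (fun τ _ => hcomp τ)
    (Continuous.intervalIntegrable (by fun_prop) _ _)
    (Continuous.intervalIntegrable (by fun_prop) _ _)
  unfold segmentAvg
  rw [← intervalIntegral.integral_const_mul, ← intervalIntegral.integral_const_mul]
  rw [one_rpow, zero_rpow (by linarith : α + 1 ≠ 0), one_mul, mul_one, zero_mul, sub_zero] at H
  calc _ = ∫ τ in (0 : ℝ)..1, τ ^ (α + 1) * (s * k' (s * τ)) := by
        congr 1; funext τ; ring
    _ = _ := by rw [H]; congr 2; funext τ; ring

theorem contDiffOn_segmentAvg (j : ℕ) : ∀ {α : ℝ}, 0 ≤ α → ∀ {h : ℝ → ℝ},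
    ContDiffOn ℝ j h (Set.Ici 0) → ContDiffOn ℝ j (segmentAvg α h) (Set.Ici 0) := by
  induction j with
  | zero =>
    intro α hα h hh
    simp only [Nat.cast_zero, contDiffOn_zero] at hh ⊢
    have hc : Continuous fun s => h (max s 0) :=
      hh.comp_continuous (by fun_prop) fun s => Set.mem_Ici.2 (le_max_right _ _)
    have heq : Set.EqOn h (fun s => h (max s 0)) (Set.Ici 0) := fun s hs => by
      simp only [max_eq_left (Set.mem_Ici.1 hs)]
    exact (continuous_segmentAvg hα hc).continuousOn.congr (segmentAvg_congr heq)
  | succ j ih =>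
    intro α hα h hh
    have hu : UniqueDiffOn ℝ (Set.Ici (0 : ℝ)) := uniqueDiffOn_Ici 0
    push_cast at hh ⊢
    rw [contDiffOn_succ_iff_derivWithin hu] at hh ⊢
    have hd : ∀ s ∈ Set.Ici (0 : ℝ),
        HasDerivWithinAt h (derivWithin h (Set.Ici 0) s) (Set.Ici 0) s :=
      fun s hs => (hh.1 s hs).hasDerivWithinAt
    have hd' := fun s (hs : s ∈ Set.Ici (0 : ℝ)) =>
      hasDerivWithinAt_segmentAvg hα hh.2.2.continuousOn hd hs
    refine ⟨fun s hs => (hd' s hs).differentiableWithinAt, by simp, ?_⟩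
    exact (ih (by linarith : 0 ≤ α + 1) hh.2.2).congr
      fun s hs => (hd' s hs).derivWithin (hu s hs)

theorem abs_rpow_sub_rpow_le {p M x y : ℝ} (hp : 1 ≤ p) (hx : x ∈ Set.Icc 0 M)
    (hy : y ∈ Set.Icc 0 M) : |x ^ p - y ^ p| ≤ p * M ^ (p - 1) * |x - y| := by
  refine (convex_Icc 0 M).norm_image_sub_le_of_norm_hasDerivWithin_le (f := fun z => z ^ p)
    (f' := fun z => p * z ^ (p - 1))
    (fun z _ => (Real.hasDerivAt_rpow_const (Or.inr hp)).hasDerivWithinAt) (fun z hz => ?_) hy hx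
  have h0 : 0 ≤ p := by linarith
  rw [Real.norm_eq_abs, abs_of_nonneg (mul_nonneg h0 (rpow_nonneg hz.1 _))]
  exact mul_le_mul_of_nonneg_left (rpow_le_rpow hz.1 hz.2 (by linarith)) h0

theorem segmentAvg_le_of_le_exp {α : ℝ} (hα : 0 ≤ α) {h : ℝ → ℝ} (hh : Continuous h)
    {M Q s : ℝ} (hM : 0 ≤ M) (hQ : 0 ≤ Q) (hs : 0 ≤ s)
    (hle : ∀ t, 0 ≤ t → h t ≤ M * exp (Q * t)) :
    segmentAvg α h s ≤ M * exp (Q * s) ∧ Q * s * segmentAvg α h s ≤ M * exp (Q * s) := by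
  have hτc : Continuous fun τ : ℝ => τ ^ α := Real.continuous_rpow_const hα
  have hpt : ∀ τ ∈ Set.Icc (0 : ℝ) 1, τ ^ α * h (s * τ) ≤ M * exp (Q * s * τ) := by
    intro τ hτ
    have h1 := hle (s * τ) (mul_nonneg hs hτ.1)
    rw [← mul_assoc] at h1
    have h2 : τ ^ α ≤ 1 := rpow_le_one hτ.1 hτ.2 hα
    calc _ ≤ τ ^ α * (M * exp (Q * s * τ)) :=
          mul_le_mul_of_nonneg_left h1 (rpow_nonneg hτ.1 _)
      _ ≤ 1 * (M * exp (Q * s * τ)) := mul_le_mul_of_nonneg_right h2 (by positivity)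
      _ = _ := one_mul _
  have hI : segmentAvg α h s ≤ ∫ τ in (0 : ℝ)..1, M * exp (Q * s * τ) :=
    intervalIntegral.integral_mono_on zero_le_one
      (Continuous.intervalIntegrable (by fun_prop) _ _)
      (Continuous.intervalIntegrable (by fun_prop) _ _) hpt
  have hQs : 0 ≤ Q * s := mul_nonneg hQ hs
  constructor
  · refine hI.trans ?_
    have : ∫ τ in (0 : ℝ)..1, M * exp (Q * s * τ) ≤ ∫ _τ in (0 : ℝ)..1, M * exp (Q * s) :=
      intervalIntegral.integral_mono_on zero_le_one
        (Continuous.intervalIntegrable (by fun_prop) _ _) (by simp) fun τ hτ =>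
        mul_le_mul_of_nonneg_left (exp_le_exp.2 (mul_le_of_le_one_right hQs hτ.2)) hM
    simpa using this
  · have hF : ∫ τ in (0 : ℝ)..1, Q * s * (M * exp (Q * s * τ)) =
        M * exp (Q * s * 1) - M * exp (Q * s * 0) :=
      intervalIntegral.integral_eq_sub_of_hasDerivAt (f := fun τ => M * exp (Q * s * τ))
        (fun τ _ => by
          have h1 : HasDerivAt (fun τ : ℝ => Q * s * τ) (Q * s) τ := by
            simpa using (hasDerivAt_id τ).const_mul (Q * s)
          refine (h1.exp.const_mul M).congr_deriv ?_
          ring)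
        (Continuous.intervalIntegrable (by fun_prop) _ _)
    have h2 := mul_le_mul_of_nonneg_left hI hQs
    rw [← intervalIntegral.integral_const_mul, hF] at h2
    simp only [mul_one, mul_zero, exp_zero] at h2
    linarith

/-- Global positive solution of the first-order nonlocal form of the radial equation. -/
theorem exists_pos_radial_profile {a b c α p : ℝ} (ha : 0 < a) (hb : 0 < b) (hc : 0 ≤ c)
    (hα : 0 ≤ α) (hp : 1 < p) :
    ∃ g : ℝ → ℝ, g 0 = a ∧ (∀ s, 0 ≤ s → 0 < g s) ∧ ∀ s, 0 ≤ s →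
      HasDerivAt g (-b * g s ^ p + c * segmentAvg α (fun t => g t ^ p) s) s := by
  have hp0 : 0 < p := by linarith
  set k : ℝ := c * a ^ (p - 1) * exp (c / b) + 1 with hk
  have hk0 : 0 < k := by positivity
  set B : ℝ → ℝ := fun t => a * exp (k * t) with hB
  have hBc : Continuous B := by fun_prop
  have hB0 : ∀ t, 0 < B t := fun t => by positivity
  have hBm : Monotone B := fun s t h => by
    simp only [hB]; gcongr
  have hBp : ∀ (q t : ℝ), B t ^ q = a ^ q * exp (k * q * t) := fun q t => by
    simp only [hB]
    rw [mul_rpow ha.le (exp_pos _).le, ← exp_mul]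
    ring_nf
  have hBd : ∀ t, HasDerivAt B (k * B t) t := fun t => by
    have h1 : HasDerivAt (fun τ : ℝ => k * τ) k t := by
      simpa using (hasDerivAt_id t).const_mul k
    refine (h1.exp.const_mul a).congr_deriv ?_
    simp only [hB]; ring
  let clamp : ℝ → ℝ → ℝ := fun t x => max 0 (min x (B t))
  have hcl : ∀ t x, clamp t x ∈ Set.Icc 0 (B t) := fun t x =>
    ⟨le_max_left _ _, max_le (hB0 t).le (min_le_right _ _)⟩
  have hcll : ∀ t x y, |clamp t x - clamp t y| ≤ |x - y| := fun t x y =>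
    (abs_max_sub_max_le_max 0 _ 0 _).trans (by
      rw [sub_self, abs_zero, max_eq_right (abs_nonneg _)]
      refine (abs_min_sub_min_le_max x _ y _).trans ?_
      rw [sub_self, abs_zero, max_eq_left (abs_nonneg _)])
  let Φ : ℝ → ℝ → ℝ := fun t x => clamp t x ^ p
  have hΦc : ∀ f, Continuous f → Continuous fun t => Φ t (f t) := fun f hf =>
    (continuous_const.max (hf.min hBc)).rpow_const fun _ => Or.inr hp0.le
  have hΦ0 : ∀ t x, 0 ≤ Φ t x := fun t x => rpow_nonneg (hcl t x).1 _
  have hΦB : ∀ t x, Φ t x ≤ B t ^ p := fun t x => rpow_le_rpow (hcl t x).1 (hcl t x).2 hp0.le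
  have hΦl : ∀ t x y, |Φ t x - Φ t y| ≤ p * B t ^ (p - 1) * |x - y| := fun t x y =>
    (abs_rpow_sub_rpow_le hp.le (hcl t x) (hcl t y)).trans
      (mul_le_mul_of_nonneg_left (hcll t x y) (mul_nonneg hp0.le (rpow_nonneg (hB0 t).le _)))
  have hΦeq : ∀ t x, 0 ≤ x → x ≤ B t → Φ t x = x ^ p := fun t x h0 h1 => by
    simp only [Φ, clamp, min_eq_left h1, max_eq_right h0]
  let N : (ℝ → ℝ) → ℝ → ℝ := fun f t => -b * Φ t (f t) + c * segmentAvg α (fun r => Φ r (f r)) t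
  obtain ⟨g, hg0, hg⟩ := exists_hasDerivAt_of_causal_lipschitz N
    (fun t => (b + c) * (p * B t ^ (p - 1)))
    (fun t => 2 * (b + c) * p * a ^ (p - 1) / (k * (p - 1)) * exp (k * (p - 1) * t)) a
    (fun f hf => (continuous_const.mul (hΦc f hf)).add
      (continuous_const.mul (continuous_segmentAvg hα (hΦc f hf))))
    (by
      have h0 : ∀ t, Φ t 0 = 0 := fun t => by
        rw [hΦeq t 0 le_rfl (hB0 t).le, zero_rpow hp0.ne']
      funext t
      simp [N, h0, segmentAvg])
    (continuous_const.mul (continuous_const.mul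
      (hBc.rpow_const fun t => Or.inl (hB0 t).ne')))
    (fun t => by have := hB0 t; positivity)
    (fun t => by
      have h1 : HasDerivAt (fun τ : ℝ => k * (p - 1) * τ) (k * (p - 1)) t := by
        simpa using (hasDerivAt_id t).const_mul (k * (p - 1))
      refine (h1.exp.const_mul _).congr_deriv ?_
      have : p - 1 ≠ 0 := by linarith
      rw [hBp]
      field_simp)
    (fun f f' hf hf' t ht D hD => by
      have hmul : ∀ r, 0 ≤ r → r ≤ t → |Φ r (f r) - Φ r (f' r)| ≤ p * B t ^ (p - 1) * D := by
        intro r hr hrt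
        refine (hΦl _ _ _).trans (mul_le_mul (mul_le_mul_of_nonneg_left
          (rpow_le_rpow (hB0 r).le (hBm hrt) (by linarith)) hp0.le) (hD r hr hrt)
          (abs_nonneg _) (mul_nonneg hp0.le (rpow_nonneg (hB0 t).le _)))
      have h1 := hmul t ht le_rfl
      have h2 := abs_segmentAvg_sub_le hα (hΦc f hf) (hΦc f' hf') ht hmul
      calc |N f t - N f' t|
          = |-b * (Φ t (f t) - Φ t (f' t)) + c * (segmentAvg α (fun r => Φ r (f r)) t -
              segmentAvg α (fun r => Φ r (f' r)) t)| := by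
            congr 1; simp only [N]; ring
        _ ≤ b * |Φ t (f t) - Φ t (f' t)| + c * |segmentAvg α (fun r => Φ r (f r)) t -
              segmentAvg α (fun r => Φ r (f' r)) t| := by
            refine (abs_add_le _ _).trans (le_of_eq ?_)
            rw [abs_mul, abs_mul, abs_neg, abs_of_pos hb, abs_of_nonneg hc]
        _ ≤ b * (p * B t ^ (p - 1) * D) + c * (p * B t ^ (p - 1) * D) := by gcongr
        _ = _ := by ring)
  have hA0 : ∀ t, 0 ≤ t → 0 ≤ segmentAvg α (fun r => Φ r (g r)) t := fun t ht =>
    segmentAvg_nonneg ht fun r _ => hΦ0 _ _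
  have hgc : ∀ S, ContinuousOn g (Set.Icc 0 S) := fun S t ht =>
    (hg t ht.1).continuousAt.continuousWithinAt
  -- the segment average only sees `g` on `[0, ∞)`, so `g` may be made globally continuous
  have hgm : Continuous fun t => g (max t 0) := by
    refine continuous_iff_continuousAt.2 fun t => ?_
    exact ContinuousAt.comp (f := fun t : ℝ => max t 0) (g := g)
      (hg _ (le_max_right _ _)).continuousAt (by fun_prop)
  have hAm : ∀ t, 0 ≤ t → segmentAvg α (fun r => Φ r (g r)) t =
      segmentAvg α (fun r => Φ r (g (max r 0))) t := fun t ht =>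
    segmentAvg_congr (fun r hr => by simp only [max_eq_left (Set.mem_Ici.1 hr)]) ht
  have hup : ∀ s, 0 ≤ s → g s ≤ B s := by
    intro s hs
    refine image_le_of_deriv_right_lt_deriv_boundary (hgc s)
      (fun t ht => (hg t ht.1).hasDerivWithinAt) (by simp [hg0, hB]) hBd (fun t ht htt => ?_)
      (Set.right_mem_Icc.2 hs)
    have ht0 : 0 ≤ t := ht.1
    have hval : Φ t (g t) = B t ^ p := by rw [htt, hΦeq t _ (hB0 t).le le_rfl]
    obtain ⟨hA1, hA2⟩ := segmentAvg_le_of_le_exp hα (hΦc _ hgm) (rpow_nonneg ha.le p)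
      (mul_pos hk0 hp0).le ht0 (fun r _ => (hΦB r (g (max r 0))).trans_eq (hBp p r))
    rw [← hAm t ht0] at hA1 hA2
    have hA := hA0 t ht0
    have hBt := hBp p t
    have hBpos : 0 < B t ^ p := rpow_pos_of_pos (hB0 t) _
    simp only [N]
    rw [hval]
    rcases le_total (k * p * t) (c / b) with hle | hle
    · have h1 : segmentAvg α (fun r => Φ r (g r)) t ≤ a ^ p * exp (c / b) :=
        hA1.trans (by gcongr)
      have h2 : c * (a ^ p * exp (c / b)) < k * a := by
        have : a ^ p = a ^ (p - 1) * a := by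
          rw [← rpow_add_one ha.ne']; ring_nf
        rw [this, hk]; nlinarith
      have h3 : k * a ≤ k * B t := by
        have : a ≤ B t := by
          have := hBm ht0
          simpa [hB] using this
        gcongr
      have h4 := mul_le_mul_of_nonneg_left h1 hc
      have h5 := mul_pos hb hBpos
      linarith
    · have h1 : c ≤ b * (k * p * t) := by
        rw [div_le_iff₀ hb] at hle; linarith
      have h2 := mul_le_mul_of_nonneg_right h1 hA
      have h3 := mul_le_mul_of_nonneg_left hA2 hb.le
      rw [← hBt] at h3
      have h4 := mul_pos hk0 (hB0 t)
      linarith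
  have hlow : ∀ s, 0 ≤ s → 0 < g s := by
    intro s hs
    set K : ℝ := b * a ^ (p - 1) + 1 with hK
    have hK0 : 0 < K := by positivity
    have hld : ∀ t, HasDerivAt (fun t => -(a * exp (-K * t))) (K * (a * exp (-K * t))) t := by
      intro t
      have h1 : HasDerivAt (fun τ : ℝ => -K * τ) (-K) t := by
        simpa using (hasDerivAt_id t).const_mul (-K)
      refine (h1.exp.const_mul a).neg.congr_deriv ?_
      ring
    have := image_le_of_deriv_right_lt_deriv_boundary (f := fun t => -g t) (hgc s).neg
      (fun t ht => (hg t ht.1).neg.hasDerivWithinAt) (by simp [hg0]) hld (fun t ht htt => ?_)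
      (Set.right_mem_Icc.2 hs)
    · have h1 : 0 < a * exp (-K * s) := by positivity
      linarith
    have ht0 : 0 ≤ t := ht.1
    have hgt : g t = a * exp (-K * t) := neg_injective htt
    have hpos : 0 < g t := by rw [hgt]; positivity
    have hga : g t ≤ a := by
      rw [hgt]
      exact mul_le_of_le_one_right ha.le (exp_le_one_iff.2 (by nlinarith))
    have hval : Φ t (g t) = g t ^ p := hΦeq t _ hpos.le (hup t ht0)
    have h1 : g t ^ p = g t ^ (p - 1) * g t := by
      rw [← rpow_add_one hpos.ne']; ring_nf
    have h2 : g t ^ (p - 1) ≤ a ^ (p - 1) := rpow_le_rpow hpos.le hga (by linarith)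
    have h3 := mul_nonneg hc (hA0 t ht0)
    have h4 : b * (g t ^ (p - 1) * g t) ≤ b * (a ^ (p - 1) * g t) := by gcongr
    simp only [N]
    rw [← hgt, hval, h1, hK]
    nlinarith
  refine ⟨g, hg0, hlow, fun s hs => ?_⟩
  have h := hg s hs
  simp only [N] at h
  rwa [hΦeq s _ (hlow s hs).le (hup s hs), segmentAvg_congr (k := fun t => g t ^ p)
    (fun r hr => hΦeq r _ (hlow r hr).le (hup r hr)) hs] at h

theorem contDiffOn_of_radial_profile {b c α p : ℝ} (hα : 0 ≤ α) {g : ℝ → ℝ}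
    (hpos : ∀ s, 0 ≤ s → 0 < g s)
    (hg : ∀ s, 0 ≤ s →
      HasDerivAt g (-b * g s ^ p + c * segmentAvg α (fun t => g t ^ p) s) s) (j : ℕ) :
    ContDiffOn ℝ j g (Set.Ici 0) := by
  have hu : UniqueDiffOn ℝ (Set.Ici (0 : ℝ)) := uniqueDiffOn_Ici 0
  induction j with
  | zero =>
    simp only [Nat.cast_zero, contDiffOn_zero]
    exact fun s hs => (hg s hs).continuousAt.continuousWithinAt
  | succ j ih =>
    push_cast
    rw [contDiffOn_succ_iff_derivWithin hu]
    refine ⟨fun s hs => (hg s hs).differentiableAt.differentiableWithinAt, by simp, ?_⟩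
    have hp : ContDiffOn ℝ j (fun t => g t ^ p) (Set.Ici 0) :=
      ih.rpow_const_of_ne fun s hs => (hpos s hs).ne'
    exact ((contDiffOn_const.mul hp).add
      (contDiffOn_const.mul (contDiffOn_segmentAvg j hα hp))).congr
      fun s hs => (hg s hs).hasDerivWithinAt.derivWithin (hu s hs)

theorem hasFDerivAt_comp_norm_sq {n : ℕ} {h : ℝ → ℝ} {h' : ℝ} {x : Euc n}
    (hd : HasDerivWithinAt h h' (Set.Ici 0) (‖x‖ ^ 2)) :
    HasFDerivAt (fun y : Euc n => h (‖y‖ ^ 2)) (h' • (2 • innerSL ℝ x)) x :=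
  hd.comp_hasFDerivAt (f := fun y : Euc n => ‖y‖ ^ 2) x
    (hasStrictFDerivAt_norm_sq x).hasFDerivAt
    (Filter.Eventually.of_forall fun y => Set.mem_Ici.2 (sq_nonneg ‖y‖))

theorem inner_gradient_comp_norm_sq {n : ℕ} {h : ℝ → ℝ} {h' : ℝ} {x : Euc n}
    (hd : HasDerivWithinAt h h' (Set.Ici 0) (‖x‖ ^ 2)) :
    ⟪x, gradient (fun y : Euc n => h (‖y‖ ^ 2)) x⟫ = 2 * ‖x‖ ^ 2 * h' := by
  rw [real_inner_comm, inner_gradient_left, (hasFDerivAt_comp_norm_sq hd).fderiv]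
  simp
  ring

/-- The Laplacian of a radial function in terms of the squared radius. -/
theorem lap_comp_norm_sq {n : ℕ} {g k : ℝ → ℝ} {k' : ℝ} {x : Euc n}
    (hg : ∀ s ∈ Set.Ici (0 : ℝ), HasDerivWithinAt g (k s) (Set.Ici 0) s)
    (hk : HasDerivWithinAt k k' (Set.Ici 0) (‖x‖ ^ 2)) :
    lap (fun y : Euc n => g (‖y‖ ^ 2)) x = 4 * ‖x‖ ^ 2 * k' + 2 * n * k (‖x‖ ^ 2) := by
  have hfst : ∀ (i : Fin n) (y : Euc n),
      fderiv ℝ (fun y : Euc n => g (‖y‖ ^ 2)) y (EuclideanSpace.single i 1) =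
        2 * (k (‖y‖ ^ 2) * y i) := by
    intro i y
    rw [(hasFDerivAt_comp_norm_sq (hg _ (sq_nonneg ‖y‖))).fderiv]
    simp [EuclideanSpace.inner_single_right]
    ring
  have hsnd : ∀ i : Fin n,
      fderiv ℝ (fun y : Euc n => 2 * (k (‖y‖ ^ 2) * y i)) x (EuclideanSpace.single i 1) =
        4 * k' * x i ^ 2 + 2 * k (‖x‖ ^ 2) := by
    intro i
    have hproj : HasFDerivAt (fun y : Euc n => y i) (EuclideanSpace.proj i : Euc n →L[ℝ] ℝ) x :=
      (EuclideanSpace.proj i : Euc n →L[ℝ] ℝ).hasFDerivAt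
    have hd := ((hasFDerivAt_comp_norm_sq hk).mul hproj).const_mul 2
    rw [show fderiv ℝ (fun y : Euc n => 2 * (k (‖y‖ ^ 2) * y i)) x = _ from hd.fderiv]
    simp [EuclideanSpace.inner_single_right]
    ring
  unfold lap
  simp only [hfst, hsnd]
  rw [Finset.sum_add_distrib, ← Finset.mul_sum, ← EuclideanSpace.real_norm_sq_eq]
  simp
  ring

/-- existence of Yamabe expanders. -/
theorem expanders_exist (n : ℕ) (hn : 3 ≤ n)
    (m β γ : ℝ)
    (hm : m = ((n : ℝ) - 2) / ((n : ℝ) + 2))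
    (hβ : 0 < β)
    (hγ : γ = (2 * β - 1) / (1 - m)) :
    ∀ lam : ℝ, 0 < lam →
      ∃ u : Euc n → ℝ, (∀ x, 0 < u x) ∧ ContDiff ℝ (⊤ : ℕ∞) u ∧ IsRadial u ∧
        u 0 = lam ∧ YamabePDE m β γ u := by
  intro lam hlam
  have hn' : (3 : ℝ) ≤ n := by exact_mod_cast hn
  have hm0 : 0 < m := by rw [hm]; apply div_pos <;> linarith
  have hm1 : m < 1 := by rw [hm, div_lt_one (by linarith)]; linarith
  have hγ' : γ = (2 * β - 1) * (n + 2) / 4 := by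
    have h1 : 1 - m = 4 / ((n : ℝ) + 2) := by
      rw [hm]; field_simp; ring
    rw [hγ, h1]; field_simp
  have hκ : 0 ≤ n * β - γ := by rw [hγ']; nlinarith
  set C : ℝ := ((n : ℝ) - 1) / m with hC
  have hC0 : 0 < C := div_pos (by linarith) hm0
  have hα : (0 : ℝ) ≤ (n : ℝ) / 2 - 1 := by linarith
  have hp : 1 < 1 / m := (one_lt_div hm0).2 hm1
  obtain ⟨g, hg0, hpos, hg⟩ := exists_pos_radial_profile (rpow_pos_of_pos hlam m)
    (div_pos hβ (mul_pos two_pos hC0)) (div_nonneg hκ (mul_pos four_pos hC0).le) hα hp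
  set b : ℝ := β / (2 * C) with hb
  set c : ℝ := (n * β - γ) / (4 * C) with hc
  set α : ℝ := (n : ℝ) / 2 - 1 with hαdef
  set p : ℝ := 1 / m with hpdef
  have hgs : ∀ j : ℕ, ContDiffOn ℝ j g (Set.Ici 0) :=
    contDiffOn_of_radial_profile hα hpos hg
  set h : ℝ → ℝ := fun t => g t ^ p with hh
  have hhs : ∀ j : ℕ, ContDiffOn ℝ j h (Set.Ici 0) := fun j =>
    (hgs j).rpow_const_of_ne fun s hs => (hpos s hs).ne'
  set h' : ℝ → ℝ := derivWithin h (Set.Ici 0) with hh'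
  have hh1 : ContDiffOn ℝ 1 h (Set.Ici 0) := by exact_mod_cast hhs 1
  have hh'c : ContinuousOn h' (Set.Ici 0) :=
    hh1.continuousOn_derivWithin (uniqueDiffOn_Ici 0) le_rfl
  have hhd : ∀ s ∈ Set.Ici (0 : ℝ), HasDerivWithinAt h (h' s) (Set.Ici 0) s := fun s hs =>
    (hh1.differentiableOn one_ne_zero s hs).hasDerivWithinAt
  refine ⟨fun x => h (‖x‖ ^ 2), fun x => rpow_pos_of_pos (hpos _ (sq_nonneg _)) _, ?_, ?_, ?_, ?_⟩
  · exact (contDiffOn_infty.2 hhs).comp_contDiff (contDiff_norm_sq ℝ) fun x => sq_nonneg ‖x‖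
  · intro x y hxy
    simp only [hxy]
  · simp only [hh, norm_zero, ne_eq, OfNat.ofNat_ne_zero, not_false_eq_true, zero_pow, hg0]
    rw [← rpow_mul hlam.le, mul_one_div_cancel hm0.ne', rpow_one]
  · intro x
    have hs : ‖x‖ ^ 2 ∈ Set.Ici (0 : ℝ) := sq_nonneg ‖x‖
    have hum : (fun y : Euc n => h (‖y‖ ^ 2) ^ m) = fun y => g (‖y‖ ^ 2) := by
      funext y
      simp only [hh]
      rw [← rpow_mul (hpos _ (sq_nonneg ‖y‖)).le, one_div_mul_cancel hm0.ne', rpow_one]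
    have hkd := ((hhd _ hs).const_mul (-b)).add
      ((hasDerivWithinAt_segmentAvg hα hh'c hhd hs).const_mul c)
    rw [hum, lap_comp_norm_sq (fun s hs => (hg s hs).hasDerivWithinAt) hkd,
      inner_gradient_comp_norm_sq (hhd _ hs)]
    have hparts := mul_segmentAvg_deriv hα hh'c hhd hs
    have hCb : C * b = β / 2 := by rw [hb]; field_simp
    have hCc : C * c = (n * β - γ) / 4 := by rw [hc]; field_simp
    have hα1 : α + 1 = n / 2 := by rw [hαdef]; ring
    change C * (4 * ‖x‖ ^ 2 * (-b * h' (‖x‖ ^ 2) + c * segmentAvg (α + 1) h' (‖x‖ ^ 2)) +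
      2 * n * (-b * h (‖x‖ ^ 2) + c * segmentAvg α h (‖x‖ ^ 2))) +
      β * (2 * ‖x‖ ^ 2 * h' (‖x‖ ^ 2)) + γ * h (‖x‖ ^ 2) = 0
    generalize h (‖x‖ ^ 2) = H at *
    generalize h' (‖x‖ ^ 2) = H' at *
    generalize segmentAvg α h (‖x‖ ^ 2) = A at *
    generalize segmentAvg (α + 1) h' (‖x‖ ^ 2) = A' at *
    rw [hα1] at hparts
    linear_combination (-4 * ‖x‖ ^ 2 * H' - 2 * n * H) * hCb + 4 * C * c * hparts + 4 * H * hCc
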